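/- Let d ≥ 2 be an even integer. Then for every integer q ≥ d − 1, one has 𝐂(d) ≤ 3·𝐂(q). In particular 𝐂(d) ≤ 3·𝐂(q_d), where q_d is the smallest integer q ≥ d−1 minimizing 𝐂(q). -/

import Mathlib

/-- A function `f : A → B` between (finite) abelian groups is differentially 1-uniform:
for every `(a, b) ≠ (0, 0)`, the equation `f (x + a) - f x = b` has at most one solution `x`. -/
def IsD1U {A B : Type} [AddCommGroup A] [AddCommGroup B] (f : A → B) : Prop :=
  ∀ a : A, ∀ b : B, (a, b) ≠ (0, 0) →
    ∀ x y : A, f (x + a) - f x = b → f (y + a) - f y = b → x = y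

/-- `𝐂(d)`: the smallest cardinality of a finite abelian group `B` admitting a
differentially 1-uniform function `ℤ/dℤ → B`. -/
noncomputable def Cd1u (d : ℕ) : ℕ :=
  sInf {n : ℕ | ∃ (B : Type) (_ : AddCommGroup B) (_ : Fintype B),
    Fintype.card B = n ∧ ∃ f : ZMod d → B, IsD1U f}

theorem IsD1U.sidon {A B : Type} [AddCommGroup A] [AddCommGroup B] {g : A → B} (hg : IsD1U g)
    {P Q R S : A} (h : P + Q = R + S) (h' : g P + g Q = g R + g S) : P = R ∨ P = S := by
  by_cases ha : P - R = 0
  · left; exact sub_eq_zero.mp ha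
  · right
    have e1 : R + (P - R) = P := by abel
    have e2 : Q + (P - R) = S := by
      have : Q + (P - R) = (P + Q) - R := by abel
      rw [this, h]; abel
    have := hg (P - R) (g P - g R) (by simp [ha]) R Q (by rw [e1]) (by
      rw [e2]
      have : g S - g Q = (g R + g S) - g R - g Q := by abel
      rw [this, ← h']; abel)
    rw [← e1, ← e2, this]

theorem isD1U_of_sidon {A B : Type} [AddCommGroup A] [AddCommGroup B] {f : A → B}
    (hf : ∀ P Q R S : A, P + Q = R + S → f P + f Q = f R + f S → P = R ∨ P = S) : IsD1U f := by
  intro a b hab x y hx hy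
  rcases hf (x + a) y x (y + a) (by abel) (by
    rw [sub_eq_iff_eq_add] at hx hy
    rw [hx, hy]; abel) with h | h
  · exfalso
    have ha : a = 0 := by simpa using h
    subst ha
    apply hab
    simp at hx
    simp [hx]
  · simpa using h

theorem exists_d1u (q : ℕ) (hq : 1 ≤ q) :
    {n : ℕ | ∃ (B : Type) (_ : AddCommGroup B) (_ : Fintype B),
    Fintype.card B = n ∧ ∃ f : ZMod q → B, IsD1U f}.Nonempty := by
  have : NeZero q := ⟨by omega⟩
  refine ⟨_, ZMod q → ZMod 3, inferInstance, inferInstance, rfl, fun x => Pi.single x 1, ?_⟩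
  apply isD1U_of_sidon
  intro P Q R S _ h
  by_contra! hc
  have := congrFun h P
  simp only [Pi.add_apply, Pi.single_apply, if_true, hc.1, hc.2, if_false] at this
  have e1 : (1 : ZMod 3) + 1 ≠ 0 + 0 := by decide
  have e2 : (1 : ZMod 3) + 0 ≠ 0 + 0 := by decide
  split_ifs at this
  · exact e1 this
  · exact e2 this

theorem extend_d1u {B : Type} [AddCommGroup B] (m q : ℕ) (hm : 1 ≤ m) (hq : m + m - 1 ≤ q)
    (g : ZMod q → B) (hg : IsD1U g) :
    IsD1U (fun x : ZMod (m + m) =>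
      (((if x.val < m then 0 else 1 : ℕ) : ZMod 3), g (x.val : ZMod q))) := by
  have : NeZero (m + m) := ⟨by omega⟩
  apply isD1U_of_sidon
  intro P Q R S h h'
  have hv := congrArg ZMod.val h
  rw [ZMod.val_add, ZMod.val_add] at hv
  have hP := ZMod.val_lt P
  have hQ := ZMod.val_lt Q
  have hR := ZMod.val_lt R
  have hS := ZMod.val_lt S
  rw [← (ZMod.val_injective (m + m)).eq_iff, ← (ZMod.val_injective (m + m)).eq_iff (b := S)]
  simp only [Prod.mk_add_mk, Prod.mk.injEq] at h'
  obtain ⟨h1, h2⟩ := h'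
  generalize P.val = p at *
  generalize Q.val = r at *
  generalize R.val = s at *
  generalize S.val = t at *
  have h3 : ((if p < m then 0 else 1) + (if r < m then 0 else 1) : ℕ)
      = (if s < m then 0 else 1) + (if t < m then 0 else 1) := by
    have h1' := h1
    rw [← Nat.cast_add, ← Nat.cast_add, ZMod.natCast_eq_natCast_iff'] at h1'
    split_ifs at h1' ⊢ <;> simp at h1' ⊢
  have hsum : p + r = s + t := by
    have key : p + r = s + t ∨ p + r = s + t + (m + m) ∨ s + t = p + r + (m + m) := by
      have a1 := Nat.div_add_mod (p + r) (m + m)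
      have a2 := Nat.div_add_mod (s + t) (m + m)
      have b1 : (p + r) / (m + m) < 2 := Nat.div_lt_of_lt_mul (by omega)
      have b2 : (s + t) / (m + m) < 2 := Nat.div_lt_of_lt_mul (by omega)
      generalize (p + r) / (m + m) = u at *
      generalize (s + t) / (m + m) = v at *
      interval_cases u <;> interval_cases v <;> omega
    split_ifs at h3 <;> omega
  have hz : ((p : ZMod q) + (r : ZMod q)) = (s : ZMod q) + (t : ZMod q) := by
    exact_mod_cast congrArg (Nat.cast : ℕ → ZMod q) hsum
  have aux : ∀ a b : ℕ, a < m + m → b < m + m → (a : ZMod q) = b →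
      a = b ∨ (a = q ∧ b = 0) ∨ (a = 0 ∧ b = q) := by
    intro a b ha hb hab
    rw [ZMod.natCast_eq_natCast_iff'] at hab
    rcases Nat.lt_or_ge a q with h | h <;> rcases Nat.lt_or_ge b q with h' | h'
    · rw [Nat.mod_eq_of_lt h, Nat.mod_eq_of_lt h'] at hab; omega
    · have : b = q := by omega
      subst this
      rw [Nat.mod_eq_of_lt h, Nat.mod_self] at hab; omega
    · have : a = q := by omega
      subst this
      rw [Nat.mod_eq_of_lt h', Nat.mod_self] at hab; omega
    · omega
  rcases hg.sidon hz h2 with h | h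
  · have := aux p s hP hR h
    omega
  · have := aux p t hP hS h
    omega

/-- Theorem 5(2) of the paper: for even `d ≥ 2` and any `q ≥ d - 1`, `𝐂(d) ≤ 3·𝐂(q)`.
In particular `𝐂(d) ≤ 3·𝐂(q_d)` for `q_d` the smallest integer `≥ d - 1` minimizing `𝐂`. -/
theorem C_le_three_mul_C_of_even (d : ℕ) (hd : 2 ≤ d) (hev : Even d) :
    ∀ q : ℕ, d - 1 ≤ q → Cd1u d ≤ 3 * Cd1u q := by
  intro q hq
  obtain ⟨m, rfl⟩ := hev
  obtain ⟨B, _, _, hB, g, hg⟩ := Nat.sInf_mem (exists_d1u q (by omega))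
  apply Nat.sInf_le
  refine ⟨ZMod 3 × B, inferInstance, inferInstance, ?_, _, extend_d1u m q (by omega) hq g hg⟩
  rw [Fintype.card_prod, ZMod.card, hB]
  rfl
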